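/- arXiv:1905.12364 — 3 statements merged into one kernel-verified Lean document; each statement's English description precedes it below -/
import Mathlib

section
/- Let σ ∈ K_n be a king permutation (no bonds). Then the number of distinct permutations π ∈ K_{n−1} with π ⪯ σ (π obtained from σ by deleting one entry and standardizing, and π itself has no bonds) equals n − sep(σ), where sep(σ) is the number of separators of σ. -/
/-- The entry at position `k` of `σ` (0-indexed) is a *vertical separator*:
there are positions `j, j+1, j+2` with `k = j+1` and `|σ j - σ (j+2)| = 1`. -/
def IsVSepPos {n : ℕ} (σ : Equiv.Perm (Fin n)) (k : Fin n) : Prop :=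
  ∃ (j : ℕ) (h : j + 2 < n), (k : ℕ) = j + 1 ∧
    (((σ ⟨j, by omega⟩).val : ℤ) - ((σ ⟨j + 2, h⟩).val : ℤ)).natAbs = 1

/-- The value `b` is a vertical separator of `σ`. -/
def IsVSepVal {n : ℕ} (σ : Equiv.Perm (Fin n)) (b : Fin n) : Prop :=
  IsVSepPos σ (σ⁻¹ b)

/-- The value `a` is a *horizontal separator* of `σ`: the values `a-1` and `a+1`
occupy adjacent positions of `σ` (their sum is `2a` and they differ by `2`). -/
def IsHSepVal {n : ℕ} (σ : Equiv.Perm (Fin n)) (a : Fin n) : Prop :=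
  ∃ (j : ℕ) (h : j + 1 < n),
    (((σ ⟨j, by omega⟩).val : ℤ) - ((σ ⟨j + 1, h⟩).val : ℤ)).natAbs = 2 ∧
    ((σ ⟨j, by omega⟩).val : ℤ) + ((σ ⟨j + 1, h⟩).val : ℤ) = 2 * (a : ℤ)

/-- `σ` has a bond at positions `j, j+1`. -/
def PermBondAt {n : ℕ} (σ : Equiv.Perm (Fin n)) (j : ℕ) (h : j + 1 < n) : Prop :=
  (((σ ⟨j, by omega⟩).val : ℤ) - ((σ ⟨j + 1, h⟩).val : ℤ)).natAbs = 1

/-- The sequence obtained from `σ` by deleting the entry at position `p`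
and standardizing. -/
def delSeq {n : ℕ} (σ : Equiv.Perm (Fin n)) (p : Fin n) : Fin (n - 1) → ℕ :=
  fun k =>
    let q : Fin n :=
      if (k : ℕ) < (p : ℕ) then ⟨k, by have := k.isLt; omega⟩
      else ⟨(k : ℕ) + 1, by have := k.isLt; omega⟩
    if (σ q).val < (σ p).val then (σ q).val else (σ q).val - 1

/-- A sequence has a bond at positions `j, j+1`. -/
def SeqBondAt {m : ℕ} (g : Fin m → ℕ) (j : ℕ) (h : j + 1 < m) : Prop :=
  ((g ⟨j, by omega⟩ : ℤ) - (g ⟨j + 1, h⟩ : ℤ)).natAbs = 1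

/-- The number of bonds of a sequence. -/
noncomputable def seqBondCount {m : ℕ} (g : Fin m → ℕ) : ℕ :=
  Nat.card {p : Fin m × Fin m //
    (p.2 : ℕ) = (p.1 : ℕ) + 1 ∧ ((g p.1 : ℤ) - (g p.2 : ℤ)).natAbs = 1}

/-- The number of bonds of `σ`. -/
noncomputable def bondCount {n : ℕ} (σ : Equiv.Perm (Fin n)) : ℕ :=
  Nat.card {p : Fin n × Fin n //
    (p.2 : ℕ) = (p.1 : ℕ) + 1 ∧ (((σ p.1).val : ℤ) - ((σ p.2).val : ℤ)).natAbs = 1}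

theorem Equiv.Perm.val_apply_mk_ne {n : ℕ} (σ : Equiv.Perm (Fin n)) {i j : ℕ} (hi : i < n)
    (hj : j < n) (hij : i ≠ j) : (σ ⟨i, hi⟩).val ≠ (σ ⟨j, hj⟩).val := fun h =>
  hij (congrArg Fin.val (σ.injective (Fin.ext h)))

theorem delSeq_of_lt {n : ℕ} (σ : Equiv.Perm (Fin n)) {p k : ℕ} (hp : p < n) (hk : k < n - 1)
    (h : k < p) : delSeq σ ⟨p, hp⟩ ⟨k, hk⟩ =
      if (σ ⟨k, by omega⟩).val < (σ ⟨p, hp⟩).val then (σ ⟨k, by omega⟩).val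
      else (σ ⟨k, by omega⟩).val - 1 := by
  simp [delSeq, h]

theorem delSeq_of_le {n : ℕ} (σ : Equiv.Perm (Fin n)) {p k : ℕ} (hp : p < n) (hk : k < n - 1)
    (h : p ≤ k) : delSeq σ ⟨p, hp⟩ ⟨k, hk⟩ =
      if (σ ⟨k + 1, by omega⟩).val < (σ ⟨p, hp⟩).val then (σ ⟨k + 1, by omega⟩).val
      else (σ ⟨k + 1, by omega⟩).val - 1 := by
  simp [delSeq, h.not_gt]

/-- Deleting two different entries of a permutation without bonds gives different patterns. -/
theorem delSeq_injective {n : ℕ} (σ : Equiv.Perm (Fin n))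
    (hking : ∀ (j : ℕ) (h : j + 1 < n), ¬ PermBondAt σ j h) :
    Function.Injective (delSeq σ) := by
  have key : ∀ (p q : ℕ) (hp : p < n) (hq : q < n), p < q →
      delSeq σ ⟨p, hp⟩ ≠ delSeq σ ⟨q, hq⟩ := by
    intro p q hp hq hpq h
    have h1 := congrFun h ⟨p, by omega⟩
    rw [delSeq_of_le σ hp _ le_rfl, delSeq_of_lt σ hq _ hpq] at h1
    have h2 := hking p (by omega)
    have h3 := σ.val_apply_mk_ne hp hq hpq.ne
    have h4 := σ.val_apply_mk_ne hp (show p + 1 < n by omega) (by omega)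
    unfold PermBondAt at h2
    split_ifs at h1 <;> omega
  intro p q h
  rcases lt_trichotomy p.val q.val with hlt | heq | hgt
  · exact absurd h (key p q p.2 q.2 hlt)
  · exact Fin.ext heq
  · exact absurd h.symm (key q p q.2 p.2 hgt)

/-- Deleting an entry `a` distinct from `x` and `y` makes `x` and `y` adjacent values iff they
were already adjacent or `a` is the only value between them. -/
theorem natAbs_standardize_eq_one_iff {x y a : ℕ} (hx : x ≠ a) (hy : y ≠ a) :
    (((if x < a then x else x - 1 : ℕ) : ℤ) - ((if y < a then y else y - 1 : ℕ) : ℤ)).natAbs = 1 ↔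
      (((x : ℤ) - y).natAbs = 1 ∨ ((x : ℤ) - y).natAbs = 2 ∧ (x : ℤ) + y = 2 * a) := by
  split_ifs <;> omega

/-- In a permutation without bonds, deleting an entry creates a bond iff it is a separator. -/
theorem exists_seqBondAt_delSeq_iff {n : ℕ} (σ : Equiv.Perm (Fin n))
    (hking : ∀ (j : ℕ) (h : j + 1 < n), ¬ PermBondAt σ j h) (p : Fin n) :
    (∃ (j : ℕ) (h : j + 1 < n - 1), SeqBondAt (delSeq σ p) j h) ↔
      IsVSepVal σ (σ p) ∨ IsHSepVal σ (σ p) := by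
  obtain ⟨p, hp⟩ := p
  simp only [IsVSepVal, Equiv.Perm.inv_def, Equiv.symm_apply_apply, IsVSepPos, IsHSepVal]
  constructor
  · rintro ⟨j, h, hb⟩
    unfold SeqBondAt at hb
    rcases lt_trichotomy (j + 1) p with hlt | rfl | hgt
    · rw [delSeq_of_lt σ hp _ (by omega), delSeq_of_lt σ hp _ hlt,
        natAbs_standardize_eq_one_iff (σ.val_apply_mk_ne _ _ (by omega))
          (σ.val_apply_mk_ne _ _ (by omega))] at hb
      exact .inr ⟨j, by omega, hb.resolve_left (hking j (by omega))⟩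
    · rw [delSeq_of_lt σ hp _ (by omega), delSeq_of_le σ hp _ le_rfl,
        natAbs_standardize_eq_one_iff (σ.val_apply_mk_ne _ _ (by omega))
          (σ.val_apply_mk_ne _ _ (by omega))] at hb
      refine .inl ⟨j, by omega, rfl, hb.resolve_right fun hb => ?_⟩
      have := hking j (by omega)
      unfold PermBondAt at this
      omega
    · rw [delSeq_of_le σ hp _ (by omega), delSeq_of_le σ hp _ (by omega),
        natAbs_standardize_eq_one_iff (σ.val_apply_mk_ne _ _ (by omega))
          (σ.val_apply_mk_ne _ _ (by omega))] at hb
      exact .inr ⟨j + 1, by omega, hb.resolve_left (hking (j + 1) (by omega))⟩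
  · rintro (⟨j, h, rfl, hb⟩ | ⟨j, h, hb⟩)
    · refine ⟨j, by omega, ?_⟩
      unfold SeqBondAt
      rw [delSeq_of_lt σ hp _ (by omega), delSeq_of_le σ hp _ le_rfl,
        natAbs_standardize_eq_one_iff (σ.val_apply_mk_ne _ _ (by omega))
          (σ.val_apply_mk_ne _ _ (by omega))]
      exact .inl hb
    · have hpj : p ≠ j := by rintro rfl; omega
      have hpj' : p ≠ j + 1 := by rintro rfl; omega
      rcases lt_or_gt_of_ne hpj with hlt | hgt
      · obtain ⟨i, rfl⟩ : ∃ i, j = i + 1 := ⟨j - 1, by omega⟩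
        refine ⟨i, by omega, ?_⟩
        unfold SeqBondAt
        rw [delSeq_of_le σ hp _ (by omega), delSeq_of_le σ hp _ (by omega),
          natAbs_standardize_eq_one_iff (σ.val_apply_mk_ne _ _ (by omega))
            (σ.val_apply_mk_ne _ _ (by omega))]
        exact .inr hb
      · refine ⟨j, by omega, ?_⟩
        unfold SeqBondAt
        rw [delSeq_of_lt σ hp _ (by omega), delSeq_of_lt σ hp _ (by omega),
          natAbs_standardize_eq_one_iff (σ.val_apply_mk_ne _ _ (by omega))
            (σ.val_apply_mk_ne _ _ (by omega))]
        exact .inr hb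

/-- for a king permutation `σ ∈ K_n` (no bonds), the number of
distinct bond-free patterns obtained from `σ` by deleting one entry and
standardizing equals `n - sep(σ)`, where `sep(σ)` is the number of separators. -/
theorem stmt4 {n : ℕ} (σ : Equiv.Perm (Fin n))
    (hking : ∀ (j : ℕ) (h : j + 1 < n), ¬ PermBondAt σ j h) :
    Set.ncard {g : Fin (n - 1) → ℕ |
        (∃ p : Fin n, g = delSeq σ p) ∧ ∀ (j : ℕ) (h : j + 1 < n - 1), ¬ SeqBondAt g j h}
      = n - Nat.card {b : Fin n // IsVSepVal σ b ∨ IsHSepVal σ b} := by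
  have hset : {g : Fin (n - 1) → ℕ |
        (∃ p : Fin n, g = delSeq σ p) ∧ ∀ (j : ℕ) (h : j + 1 < n - 1), ¬ SeqBondAt g j h}
      = (fun b => delSeq σ (σ⁻¹ b)) '' {b : Fin n | IsVSepVal σ b ∨ IsHSepVal σ b}ᶜ := by
    ext g
    simp only [Set.mem_ofPred_eq, Set.mem_image, Set.mem_compl_iff]
    constructor
    · rintro ⟨⟨p, rfl⟩, hg⟩
      refine ⟨σ p, fun h => ?_, by simp⟩
      obtain ⟨j, hj, hb⟩ := (exists_seqBondAt_delSeq_iff σ hking p).2 h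
      exact hg j hj hb
    · rintro ⟨b, hb, rfl⟩
      refine ⟨⟨_, rfl⟩, fun j hj h => hb ?_⟩
      simpa using (exists_seqBondAt_delSeq_iff σ hking (σ⁻¹ b)).1 ⟨j, hj, h⟩
  have hinj : Function.Injective fun b => delSeq σ (σ⁻¹ b) :=
    (delSeq_injective σ hking).comp (σ⁻¹).injective
  rw [hset, Set.ncard_image_of_injective _ hinj, Set.ncard_compl, Nat.card_fin]
  rfl
end

section
/- The expected number of values that are simultaneously vertical and horizontal separators of a uniformly random permutation of S_n (n sufficiently large, say n ≥ 5) is 4(n−3)²/(n(n−1)(n−2)). -/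
open Finset in
/-- The number of permutations sending a family `f` to a family `g` with the same coincidences. -/
theorem card_perm_comp_eq {α ι : Type*} [Fintype α] [DecidableEq α] [Fintype ι] (f g : ι → α)
    (h : ∀ a b, f a = f b ↔ g a = g b) :
    Nat.card {σ : Equiv.Perm α // ⇑σ ∘ f = g} =
      (Fintype.card α - (univ.image f).card).factorial := by
  classical
  have hF : ∃ F : Set.range f → Set.range g, ∀ a, (F ⟨f a, a, rfl⟩ : α) = g a :=
    ⟨fun x => ⟨g x.2.choose, _, rfl⟩, fun a =>
      (h _ _).1 (Exists.choose_spec (⟨a, rfl⟩ : f a ∈ Set.range f))⟩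
  obtain ⟨F, hF⟩ := hF
  have hbij : Function.Bijective F := by
    constructor
    · rintro ⟨_, a, rfl⟩ ⟨_, b, rfl⟩ hab
      have := congrArg Subtype.val hab
      rw [hF, hF] at this
      exact Subtype.ext ((h _ _).2 this)
    · rintro ⟨_, a, rfl⟩
      exact ⟨⟨f a, a, rfl⟩, Subtype.ext (hF a)⟩
  let e : {x // x ∈ Set.range f} ≃ {x // x ∈ Set.range g} := Equiv.ofBijective F hbij
  have hσ₀ : ⇑(e.extendSubtype) ∘ f = g := by
    funext a
    simp only [Function.comp]
    rw [Equiv.extendSubtype_apply_of_mem e (f a) ⟨a, rfl⟩]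
    exact hF a
  set σ₀ := e.extendSubtype
  have h1 : {σ : Equiv.Perm α // ⇑σ ∘ f = g} ≃
      {σ : Equiv.Perm α // ∀ a, ¬ (a ∉ univ.image f) → σ a = a} :=
    (Equiv.mulLeft σ₀⁻¹).subtypeEquiv fun σ => by
      rw [← hσ₀]
      simp [funext_iff, Equiv.symm_apply_eq]
  rw [Nat.card_congr (h1.trans (Equiv.Perm.subtypeEquivSubtypePerm fun a => a ∉ univ.image f).symm),
    Nat.card_eq_fintype_card, Fintype.card_perm, Fintype.card_subtype_compl, Fintype.card_coe]

/-- `d 0, d 1, d 2` are consecutive and `d 3, d 4` are neighbours avoiding `d 1`. -/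
def IsSepPattern {n : ℕ} (d : Fin 5 → Fin n) : Prop :=
  (d 0 : ℕ) + 1 = d 1 ∧ (d 1 : ℕ) + 1 = d 2 ∧ ((d 3 : ℕ) + 1 = d 4 ∨ (d 4 : ℕ) + 1 = d 3) ∧
    (d 3 : ℕ) ≠ d 1 ∧ (d 4 : ℕ) ≠ d 1

/-- The involution exchanging the roles of positions and values in a separator pattern. -/
def sepSwap : Fin 5 → Fin 5 := ![3, 1, 4, 0, 2]

theorem card_sep_eq_card_pattern {n : ℕ} (σ : Equiv.Perm (Fin n)) :
    Nat.card {b : Fin n // IsVSepVal σ b ∧ IsHSepVal σ b} =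
      Nat.card {d : Fin 5 → Fin n // IsSepPattern d ∧ IsSepPattern (⇑σ ∘ d ∘ sepSwap)} := by
  symm
  have key : ∀ d : Fin 5 → Fin n, IsSepPattern d → IsSepPattern (⇑σ ∘ d ∘ sepSwap) →
      IsVSepVal σ (σ (d 1)) ∧ IsHSepVal σ (σ (d 1)) := by
    rintro d ⟨h1, h2, h3, h4, h5⟩ ⟨g1, g2, g3, g4, g5⟩
    simp only [sepSwap, Function.comp, Matrix.cons_val] at g1 g2 g3 g4 g5
    constructor
    · have e2 : (d 0 : ℕ) + 2 < n := by have := (d 2).2; omega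
      have e3 : (⟨(d 0 : ℕ) + 2, e2⟩ : Fin n) = d 2 := Fin.ext (by simp; omega)
      refine ⟨d 0, e2, by simp [h1], ?_⟩
      simp only [Fin.eta, e3]
      omega
    · rcases h3 with h3 | h3
      · have e2 : (d 3 : ℕ) + 1 < n := by have := (d 4).2; omega
        have e3 : (⟨(d 3 : ℕ) + 1, e2⟩ : Fin n) = d 4 := Fin.ext h3
        refine ⟨d 3, e2, ?_⟩
        simp only [Fin.eta, e3]
        omega
      · have e2 : (d 4 : ℕ) + 1 < n := by have := (d 3).2; omega
        have e3 : (⟨(d 4 : ℕ) + 1, e2⟩ : Fin n) = d 3 := Fin.ext h3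
        refine ⟨d 4, e2, ?_⟩
        simp only [Fin.eta, e3]
        omega
  refine Nat.card_eq_of_bijective
    (fun d => (⟨σ (d.1 1), key d.1 d.2.1 d.2.2⟩ : {b : Fin n // IsVSepVal σ b ∧ IsHSepVal σ b}))
    ⟨?_, ?_⟩
  · rintro ⟨d, ⟨h1, h2, h3, h4, h5⟩, ⟨g1, g2, g3, g4, g5⟩⟩
      ⟨d', ⟨h1', h2', h3', h4', h5'⟩, ⟨g1', g2', g3', g4', g5'⟩⟩ hd
    simp only [sepSwap, Function.comp, Matrix.cons_val, Subtype.mk.injEq,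
      EmbeddingLike.apply_eq_iff_eq] at g1 g2 g1' g2' hd
    rw [← hd] at h1' h2' g1' g2'
    apply Subtype.ext
    funext i
    fin_cases i
    · exact Fin.ext (by simp; omega)
    · exact hd
    · exact Fin.ext (by simp; omega)
    · exact σ.injective (Fin.ext (by simp; omega))
    · exact σ.injective (Fin.ext (by simp; omega))
  · rintro ⟨b, ⟨j, hj, hjk, hv⟩, ⟨k, hk, hh, hs⟩⟩
    have hp : σ ⟨j + 1, by omega⟩ = b := by
      rw [← Equiv.Perm.eq_inv_iff_eq]
      exact Fin.ext hjk.symm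
    have ne : ∀ x y : Fin n, (x : ℕ) ≠ y → (σ x : ℕ) ≠ σ y := fun x y h h' =>
      h (congrArg Fin.val (σ.injective (Fin.ext h')))
    have ne' : ∀ x y : Fin n, (σ x : ℕ) ≠ σ y → (x : ℕ) ≠ y := fun x y h h' =>
      h (by rw [Fin.ext h'])
    rcases (show ((σ ⟨k, by omega⟩ : ℕ) + 1 = b ∧ (b : ℕ) + 1 = σ ⟨k + 1, hk⟩) ∨
        ((σ ⟨k + 1, hk⟩ : ℕ) + 1 = b ∧ (b : ℕ) + 1 = σ ⟨k, by omega⟩) by omega)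
      with ⟨hb, hb'⟩ | ⟨hb, hb'⟩
    · refine ⟨⟨![⟨j, by omega⟩, ⟨j + 1, by omega⟩, ⟨j + 2, hj⟩, ⟨k, by omega⟩, ⟨k + 1, hk⟩],
        ?_, ?_⟩, Subtype.ext hp⟩
      · refine ⟨rfl, rfl, Or.inl rfl, ne' _ _ ?_, ne' _ _ ?_⟩ <;> simp [hp] <;> omega
      · refine ⟨?_, ?_, ?_, ne _ _ ?_, ne _ _ ?_⟩ <;>
          simp [sepSwap, hp] <;> omega
    · refine ⟨⟨![⟨j, by omega⟩, ⟨j + 1, by omega⟩, ⟨j + 2, hj⟩, ⟨k + 1, hk⟩, ⟨k, by omega⟩],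
        ?_, ?_⟩, Subtype.ext hp⟩
      · refine ⟨rfl, rfl, Or.inr rfl, ne' _ _ ?_, ne' _ _ ?_⟩ <;> simp [hp] <;> omega
      · refine ⟨?_, ?_, ?_, ne _ _ ?_, ne _ _ ?_⟩ <;>
          simp [sepSwap, hp] <;> omega

theorem card_injective_pattern (m : ℕ) :
    Nat.card {d : Fin 5 → Fin (m + 5) // IsSepPattern d ∧ Function.Injective d} =
      2 * ((m + 2) * (m + 1)) := by
  have hc : Nat.card (Bool × Fin (m + 2) × Fin (m + 1)) = 2 * ((m + 2) * (m + 1)) := by simp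
  rw [← hc]
  symm
  let u (i : Fin (m + 2)) (j : Fin (m + 1)) : ℕ := if (j : ℕ) < i then i + 1 else i
  let v (i : Fin (m + 2)) (j : Fin (m + 1)) : ℕ := if (j : ℕ) < i then j else j + 3
  have huv : ∀ i j, u i j + 2 < m + 5 ∧ v i j + 1 < m + 5 ∧
      (v i j + 1 < u i j ∨ u i j + 2 < v i j) := by
    intro i j
    simp only [u, v]
    split_ifs <;> omega
  have hinj : ∀ i j i' j', u i j = u i' j' → v i j = v i' j' → i = i' ∧ j = j' := by
    intro i j i' j'
    simp only [u, v, Fin.ext_iff]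
    split_ifs <;> omega
  have hsurj : ∀ c l : ℕ, c + 2 < m + 5 → l + 1 < m + 5 → (l + 1 < c ∨ c + 2 < l) →
      ∃ i j, u i j = c ∧ v i j = l := by
    rintro c l hc hl (h | h)
    · refine ⟨⟨c - 1, by omega⟩, ⟨l, by omega⟩, ?_⟩
      simp only [u, v]
      split_ifs <;> omega
    · refine ⟨⟨c, by omega⟩, ⟨l - 3, by omega⟩, ?_⟩
      simp only [u, v]
      split_ifs <;> omega
  clear_value u v
  let F : Bool × Fin (m + 2) × Fin (m + 1) → Fin 5 → Fin (m + 5) := fun t =>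
    have h := huv t.2.1 t.2.2
    ![⟨u t.2.1 t.2.2, by omega⟩, ⟨u t.2.1 t.2.2 + 1, by omega⟩, ⟨u t.2.1 t.2.2 + 2, by omega⟩,
      ⟨v t.2.1 t.2.2 + if t.1 then 1 else 0, by split_ifs <;> omega⟩,
      ⟨v t.2.1 t.2.2 + if t.1 then 0 else 1, by split_ifs <;> omega⟩]
  have hF : ∀ t, IsSepPattern (F t) ∧ Function.Injective (F t) := by
    rintro ⟨x, i, j⟩
    have h := huv i j
    constructor
    · cases x <;> simp [F, IsSepPattern] <;> omega
    · intro a b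
      cases x <;> fin_cases a <;> fin_cases b <;> simp [F] <;> omega
  refine Nat.card_eq_of_bijective (fun t => ⟨F t, hF t⟩) ⟨?_, ?_⟩
  · rintro ⟨x, i, j⟩ ⟨x', i', j'⟩ h
    have h' := congrArg Subtype.val h
    have h0 := congrArg Fin.val (congrFun h' 0)
    have h3 := congrArg Fin.val (congrFun h' 3)
    have h4 := congrArg Fin.val (congrFun h' 4)
    have key : x = x' ∧ v i j = v i' j' := by
      cases x <;> cases x' <;> simp [F] at h3 h4 ⊢ <;> omega
    obtain ⟨rfl, rfl⟩ := hinj i j i' j' h0 key.2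
    rw [key.1]
  · rintro ⟨d, ⟨h1, h2, h3, h4, h5⟩, hd⟩
    have ne : ∀ a b, a ≠ b → (d a : ℕ) ≠ d b := fun a b hab h => hab (hd (Fin.ext h))
    have e1 := ne 3 0 (by decide)
    have e2 := ne 4 0 (by decide)
    have e3 := ne 3 2 (by decide)
    have e4 := ne 4 2 (by decide)
    have b2 := (d 2).2
    have b3 := (d 3).2
    have b4 := (d 4).2
    rcases h3 with h3 | h3
    · obtain ⟨i, j, hi, hj⟩ := hsurj (d 0) (d 3) (by omega) (by omega) (by omega)
      refine ⟨(false, i, j), Subtype.ext (funext fun a => Fin.ext ?_)⟩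
      fin_cases a <;> simp [F, hi, hj] <;> omega
    · obtain ⟨i, j, hi, hj⟩ := hsurj (d 0) (d 4) (by omega) (by omega) (by omega)
      refine ⟨(true, i, j), Subtype.ext (funext fun a => Fin.ext ?_)⟩
      fin_cases a <;> simp [F, hi, hj] <;> omega

/-- The pattern in which the `x`-chosen end of the pair `d 3, d 4` coincides with the `y`-chosen end
of the triple `d 0, d 1, d 2`. -/
def overlapPattern {m : ℕ} (x y : Bool) (t : Fin (m + 2)) : Fin 5 → Fin (m + 5) :=
  let c : ℕ := if y then t else t + 1
  let s : ℕ := if y then t + 2 else t + 1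
  let r : ℕ := if y then t + 3 else t
  ![⟨c, by grind⟩, ⟨c + 1, by grind⟩, ⟨c + 2, by grind⟩,
    ⟨if x then r else s, by grind⟩, ⟨if x then s else r, by grind⟩]

/-- The end of the pair `d 3, d 4` chosen by `x`. -/
def pairEnd (x : Bool) : Fin 5 := if x then 4 else 3

/-- The end of the triple `d 0, d 1, d 2` chosen by `y`. -/
def tripleEnd (y : Bool) : Fin 5 := if y then 2 else 0

theorem tripleEnd_ne_pairEnd : ∀ x y, tripleEnd y ≠ pairEnd x := by
  decide

theorem isSepPattern_overlapPattern {m : ℕ} (x y : Bool) (t : Fin (m + 2)) :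
    IsSepPattern (overlapPattern x y t) := by
  cases x <;> cases y <;> simp [overlapPattern, IsSepPattern] <;> omega

theorem overlapPattern_pairEnd {m : ℕ} (x y : Bool) (t : Fin (m + 2)) :
    overlapPattern x y t (pairEnd x) = overlapPattern x y t (tripleEnd y) := by
  cases x <;> cases y <;> simp [overlapPattern, pairEnd, tripleEnd]

theorem exists_eq_overlapPattern {m : ℕ} {d : Fin 5 → Fin (m + 5)} (h : IsSepPattern d)
    {x y : Bool} (hxy : d (pairEnd x) = d (tripleEnd y)) : ∃ t, overlapPattern x y t = d := by
  obtain ⟨h1, h2, h3, h4, h5⟩ := h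
  rw [Fin.ext_iff] at hxy
  have b2 := (d 2).2
  have b3 := (d 3).2
  have b4 := (d 4).2
  refine ⟨⟨if y then (d 0 : ℕ) else d 0 - 1, ?_⟩, funext fun a => Fin.ext ?_⟩
  · cases x <;> cases y <;> simp [pairEnd, tripleEnd] at hxy ⊢ <;> omega
  · cases x <;> cases y <;> fin_cases a <;>
      simp [pairEnd, tripleEnd, overlapPattern] at hxy ⊢ <;> omega

theorem overlapPattern_injective {m : ℕ} {x x' y y' : Bool} {t t' : Fin (m + 2)}
    (h : overlapPattern x y t = overlapPattern x' y' t') : x = x' ∧ y = y' ∧ t = t' := by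
  have h0 := congrArg Fin.val (congrFun h 0)
  have h3 := congrArg Fin.val (congrFun h 3)
  have h4 := congrArg Fin.val (congrFun h 4)
  rw [Fin.ext_iff]
  cases x <;> cases x' <;> cases y <;> cases y' <;>
    simp [overlapPattern] at h0 h3 h4 ⊢ <;> omega

theorem exists_pairEnd_eq_tripleEnd {n : ℕ} {d : Fin 5 → Fin n} (h : IsSepPattern d)
    (hd : ¬ Function.Injective d) : ∃ x y, d (pairEnd x) = d (tripleEnd y) := by
  by_contra! hne
  apply hd
  obtain ⟨h1, h2, h3, h4, h5⟩ := h
  have e1 := hne false false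
  have e2 := hne false true
  have e3 := hne true false
  have e4 := hne true true
  simp [pairEnd, tripleEnd, Fin.ext_iff] at e1 e2 e3 e4
  intro a b
  rw [Fin.ext_iff]
  fin_cases a <;> fin_cases b <;> simp <;> omega

theorem card_overlap_pattern (m : ℕ) (x y : Bool) :
    Nat.card {d : Fin 5 → Fin (m + 5) // IsSepPattern d ∧ d (pairEnd x) = d (tripleEnd y)} =
      m + 2 := by
  rw [← Nat.card_fin (m + 2)]
  symm
  exact Nat.card_eq_of_bijective (fun t => ⟨overlapPattern x y t,
      isSepPattern_overlapPattern x y t, overlapPattern_pairEnd x y t⟩)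
    ⟨fun _ _ h => (overlapPattern_injective (congrArg Subtype.val h)).2.2,
      fun d => (exists_eq_overlapPattern d.2.1 d.2.2).imp fun _ ht => Subtype.ext ht⟩

theorem card_not_injective_pattern (m : ℕ) :
    Nat.card {d : Fin 5 → Fin (m + 5) // IsSepPattern d ∧ ¬ Function.Injective d} =
      4 * (m + 2) := by
  have hc : Nat.card (Bool × Bool × Fin (m + 2)) = 4 * (m + 2) := by simp; ring
  rw [← hc]
  symm
  refine Nat.card_eq_of_bijective (fun t => ⟨overlapPattern t.1 t.2.1 t.2.2,
      isSepPattern_overlapPattern _ _ _, fun h => ?_⟩) ⟨fun t t' h => ?_, fun d => ?_⟩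
  · exact tripleEnd_ne_pairEnd _ _ (h (overlapPattern_pairEnd t.1 t.2.1 t.2.2)).symm
  · obtain ⟨h1, h2, h3⟩ := overlapPattern_injective (congrArg Subtype.val h)
    exact Prod.ext h1 (Prod.ext h2 h3)
  · obtain ⟨x, y, hxy⟩ := exists_pairEnd_eq_tripleEnd d.2.1 d.2.2
    obtain ⟨t, ht⟩ := exists_eq_overlapPattern d.2.1 hxy
    exact ⟨(x, y, t), Subtype.ext ht⟩

open Finset in
theorem card_perm_comp_mem {α ι : Type*} [Fintype α] [DecidableEq α] [Fintype ι] (f : ι → α)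
    (P : (ι → α) → Prop) (h : ∀ g, P g → ∀ a b, f a = f b ↔ g a = g b) :
    Nat.card {σ : Equiv.Perm α // P (⇑σ ∘ f)} =
      Nat.card {g // P g} * (Fintype.card α - (univ.image f).card).factorial := by
  classical
  rw [← Nat.card_congr (Equiv.sigmaSubtypeFiberEquivSubtype
    (fun σ : Equiv.Perm α => ⇑σ ∘ f) (p := fun σ => P (⇑σ ∘ f)) (q := P) fun _ => Iff.rfl),
    Nat.card_sigma, Finset.sum_congr rfl fun g _ => card_perm_comp_eq f g.1 (h g.1 g.2)]
  simp

theorem sepSwap_involutive : Function.Involutive sepSwap := by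
  intro i
  fin_cases i <;> rfl

theorem card_perm_of_injective_pattern {m : ℕ} {d : Fin 5 → Fin (m + 5)}
    (hd : Function.Injective d) :
    Nat.card {σ : Equiv.Perm (Fin (m + 5)) // IsSepPattern (⇑σ ∘ d ∘ sepSwap)} =
      2 * ((m + 2) * (m + 1)) * m.factorial := by
  have hinj : Function.Injective (d ∘ sepSwap) := hd.comp sepSwap_involutive.injective
  have := card_perm_comp_mem (d ∘ sepSwap) (fun e => IsSepPattern e ∧ Function.Injective e)
    fun g hg a b => by rw [hinj.eq_iff, hg.2.eq_iff]
  rw [card_injective_pattern, Finset.card_image_of_injective _ hinj] at this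
  simpa [(Equiv.injective _).comp hinj] using this

theorem card_perm_of_not_injective_pattern {m : ℕ} {d : Fin 5 → Fin (m + 5)}
    (h : IsSepPattern d) (hd : ¬ Function.Injective d) :
    Nat.card {σ : Equiv.Perm (Fin (m + 5)) // IsSepPattern (⇑σ ∘ d ∘ sepSwap)} =
      (m + 2) * (m + 1).factorial := by
  obtain ⟨x, y, hxy⟩ := exists_pairEnd_eq_tripleEnd h hd
  have hs : ∀ x, sepSwap (pairEnd x) = tripleEnd x := by decide
  have hs' : ∀ y, sepSwap (tripleEnd y) = pairEnd y := by decide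
  have := card_perm_comp_mem (d ∘ sepSwap)
    (fun e => IsSepPattern e ∧ e (pairEnd y) = e (tripleEnd x)) ?_
  · rw [card_overlap_pattern] at this
    have hcard : (Finset.univ.image (d ∘ sepSwap)).card = 4 := by
      obtain ⟨t, rfl⟩ := exists_eq_overlapPattern h hxy
      have himage : Finset.univ.image (overlapPattern x y t ∘ sepSwap) =
          (Finset.univ.erase (pairEnd x)).image (overlapPattern x y t) := by
        ext p
        simp only [Finset.mem_image, Finset.mem_univ, true_and, Finset.mem_erase, and_true,
          Function.comp]
        constructor
        · rintro ⟨a, rfl⟩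
          by_cases ha : sepSwap a = pairEnd x
          · exact ⟨tripleEnd y, ha ▸ tripleEnd_ne_pairEnd x y, by rw [ha, hxy]⟩
          · exact ⟨_, ha, rfl⟩
        · rintro ⟨a, -, rfl⟩
          exact ⟨sepSwap a, by rw [sepSwap_involutive a]⟩
      rw [himage, Finset.card_image_of_injOn, Finset.card_erase_of_mem (Finset.mem_univ _)]
      · rfl
      intro a ha b hb
      simp only [Fin.ext_iff]
      cases x <;> cases y <;> fin_cases a <;> fin_cases b <;>
        simp [overlapPattern, pairEnd] at ha hb ⊢ <;> omega
    rw [hcard] at this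
    simpa [hs, hs', hxy] using this
  · rintro e ⟨he, hexy⟩ a b
    obtain ⟨t, rfl⟩ := exists_eq_overlapPattern h hxy
    obtain ⟨t', rfl⟩ := exists_eq_overlapPattern he hexy
    simp only [Fin.ext_iff]
    cases x <;> cases y <;> fin_cases a <;> fin_cases b <;>
      simp [overlapPattern, sepSwap] <;> omega

theorem sum_card_sep (m : ℕ) :
    ∑ σ : Equiv.Perm (Fin (m + 5)), Nat.card {b // IsVSepVal σ b ∧ IsHSepVal σ b} =
      4 * (m + 2) ^ 2 * (m + 2).factorial := by
  classical
  have hsum : ∀ (f : (Fin 5 → Fin (m + 5)) → ℕ) (P : (Fin 5 → Fin (m + 5)) → Prop) (c : ℕ)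
      (_ : DecidablePred P), (∀ d, P d → f d = c) → ∑ d with P d, f d = Nat.card {d // P d} * c := by
    intro f P c _ hf
    rw [Finset.sum_congr rfl fun d hd => hf d (Finset.mem_filter.1 hd).2]
    simp [Fintype.card_subtype]
  calc _ = ∑ σ : Equiv.Perm (Fin (m + 5)), ∑ d : Fin 5 → Fin (m + 5),
        if IsSepPattern d ∧ IsSepPattern (⇑σ ∘ d ∘ sepSwap) then 1 else 0 := by
        simp_rw [card_sep_eq_card_pattern]
        simp [Fintype.card_subtype]
    _ = ∑ d : Fin 5 → Fin (m + 5) with IsSepPattern d,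
        Nat.card {σ : Equiv.Perm (Fin (m + 5)) // IsSepPattern (⇑σ ∘ d ∘ sepSwap)} := by
        rw [Finset.sum_comm, Finset.sum_filter]
        refine Finset.sum_congr rfl fun d _ => ?_
        by_cases hd : IsSepPattern d <;> simp [hd, Fintype.card_subtype]
    _ = _ := by
        rw [← Finset.sum_filter_add_sum_filter_not _ Function.Injective, Finset.filter_filter,
          Finset.filter_filter, hsum _ (fun d => IsSepPattern d ∧ Function.Injective d) _ _
            fun d hd => card_perm_of_injective_pattern hd.2,
          hsum _ (fun d => IsSepPattern d ∧ ¬ Function.Injective d) _ _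
            fun d hd => card_perm_of_not_injective_pattern hd.1 hd.2,
          card_injective_pattern, card_not_injective_pattern, Nat.factorial_succ (m + 1),
          Nat.factorial_succ m]
        ring

/-- the expected number of values that are simultaneously
vertical and horizontal separators of a uniformly random permutation of `S_n`
is `4(n-3)² / (n(n-1)(n-2))`. -/
theorem stmt15 {n : ℕ} (hn : 5 ≤ n) :
    (∑ σ : Equiv.Perm (Fin n), (Nat.card {b : Fin n // IsVSepVal σ b ∧ IsHSepVal σ b} : ℚ))
        / (n.factorial : ℚ)
      = 4 * ((n : ℚ) - 3) ^ 2 / ((n : ℚ) * ((n : ℚ) - 1) * ((n : ℚ) - 2)) := by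
  obtain ⟨m, rfl⟩ := Nat.exists_eq_add_of_le' hn
  rw [← Nat.cast_sum, sum_card_sep]
  have h2 : ((m + 2).factorial : ℚ) ≠ 0 := by positivity
  simp only [Nat.factorial_succ (m + 4), Nat.factorial_succ (m + 3), Nat.factorial_succ (m + 2)]
  push_cast
  rw [show ((m : ℚ) + 5 - 1) = m + 4 by ring, show ((m : ℚ) + 5 - 2) = m + 3 by ring]
  field_simp
  ring
end

section
/- The expected total number of separators (vertical or horizontal, counted once each) of a uniformly random permutation of S_n (n ≥ 5) is 4(n³ − 6n² + 14n − 13)/(n(n−1)(n−2)), and this tends to 4 as n → ∞. -/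
open Finset in
theorem card_perm_extending {n k : ℕ} (c g : Fin k → Fin n) (hc : Function.Injective c)
    (hg : Function.Injective g) :
    #{σ : Equiv.Perm (Fin n) | ⇑σ ∘ c = g} = (n - k).factorial := by
  obtain ⟨σ₀, h₀⟩ : ∃ σ₀ : Equiv.Perm (Fin n), ∀ i, σ₀ (c i) = g i := by
    let e : {x // x ∈ Set.range c} ≃ {x // x ∈ Set.range g} :=
      (Equiv.ofInjective c hc).symm.trans (Equiv.ofInjective g hg)
    refine ⟨e.extendSubtype, fun i => ?_⟩
    rw [Equiv.extendSubtype_apply_of_mem e (c i) ⟨i, rfl⟩]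
    have h : (Equiv.ofInjective c hc).symm ⟨c i, ⟨i, rfl⟩⟩ = i := by
      rw [Equiv.symm_apply_eq]; rfl
    simp only [e, Equiv.trans_apply, h, Equiv.ofInjective_apply]
  have hcard : Fintype.card {x : Fin n // x ∉ Set.range c} = n - k := by
    rw [Fintype.card_subtype_compl, Fintype.card_fin, Fintype.card_congr
      (Equiv.ofInjective c hc).symm, Fintype.card_fin]
  rw [← hcard, ← Fintype.card_perm, Fintype.card_congr
    (Equiv.Perm.subtypeEquivSubtypePerm (fun x : Fin n => x ∉ Set.range c)),
    ← Fintype.card_subtype]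
  refine Fintype.card_congr ((Equiv.mulLeft σ₀⁻¹).subtypeEquiv fun σ => ?_)
  simp only [not_not, Set.mem_range, forall_exists_index, forall_apply_eq_imp_iff,
    Equiv.coe_mulLeft, Equiv.Perm.mul_apply, Equiv.Perm.inv_eq_iff_eq, h₀, funext_iff,
    Function.comp_apply]

open Finset in
theorem card_perm_comp_prop {n k : ℕ} (c : Fin k → Fin n) (hc : Function.Injective c)
    (P : (Fin k → Fin n) → Prop) [DecidablePred P] :
    #{σ : Equiv.Perm (Fin n) | P (σ ∘ c)} =
      #{g : Fin k → Fin n | Function.Injective g ∧ P g} * (n - k).factorial := by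
  rw [card_eq_sum_card_fiberwise (f := fun σ : Equiv.Perm (Fin n) => ⇑σ ∘ c)
    (t := {g : Fin k → Fin n | Function.Injective g ∧ P g})]
  · rw [sum_const_nat]
    intro g hg
    simp only [mem_filter, mem_univ, true_and] at hg
    rw [← card_perm_extending c g hc hg.1]
    congr 1
    ext σ
    simp only [mem_filter, mem_univ, true_and, and_iff_right_iff_imp]
    rintro rfl
    exact hg.2
  · intro σ hσ
    simp only [coe_filter, mem_univ, true_and, Set.mem_ofPred_eq] at hσ ⊢
    exact ⟨σ.injective.comp hc, hσ⟩

/-- The positions `j, j+1, j+2` and `q, q+1` are distinct. -/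
def FarPair {n : ℕ} (x : Fin (n - 2) × Fin (n - 1)) : Prop :=
  (x.2 : ℕ) + 1 < x.1 ∨ (x.1 : ℕ) + 2 < x.2

instance {n : ℕ} : DecidablePred (FarPair (n := n)) := fun x => by
  unfold FarPair; infer_instance

/-- The position intervals `j, j+1, j+2` and `q, q+1` share exactly one endpoint. -/
def TouchingPair {n : ℕ} (x : Fin (n - 2) × Fin (n - 1)) : Prop :=
  (x.2 : ℕ) + 1 = x.1 ∨ (x.1 : ℕ) + 2 = x.2

instance {n : ℕ} : DecidablePred (TouchingPair (n := n)) := fun x => by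
  unfold TouchingPair; infer_instance

open Finset in
theorem card_touchingPair (n : ℕ) :
    #{x : Fin (n - 2) × Fin (n - 1) | TouchingPair x} = 2 * (n - 3) := by
  have : #(univ : Finset (Fin (n - 3) × Bool)) = 2 * (n - 3) := by simp [mul_comm]
  rw [← this, eq_comm]
  refine card_nbij (fun y => if y.2 then (⟨y.1, by omega⟩, ⟨y.1 + 2, by omega⟩)
    else (⟨y.1 + 1, by omega⟩, ⟨y.1, by omega⟩)) ?_ ?_ ?_
  · rintro ⟨i, _ | _⟩ - <;> simp only [coe_filter, mem_univ, true_and, Set.mem_ofPred_eq] <;>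
      simp [TouchingPair]
  · rintro ⟨i, _ | _⟩ - ⟨j, _ | _⟩ - h <;> simp [Fin.ext_iff] at h ⊢ <;> omega
  · rintro ⟨⟨i, hi⟩, ⟨j, hj⟩⟩ h
    simp only [coe_filter, mem_univ, true_and, Set.mem_ofPred_eq] at h
    simp only [TouchingPair] at h
    rcases h with h | h
    · exact ⟨(⟨j, by omega⟩, false), by simp, by simp [h]⟩
    · exact ⟨(⟨i, by omega⟩, true), by simp, by simp [h]⟩

open Finset in
theorem card_farPair (n : ℕ) :
    #{x : Fin (n - 2) × Fin (n - 1) | FarPair x} = (n - 3) * (n - 4) := by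
  have : #(univ : Finset (Fin (n - 3))).offDiag = (n - 3) * (n - 4) := by
    rw [offDiag_card, card_univ, Fintype.card_fin, ← Nat.mul_sub_one]; rfl
  rw [← this, eq_comm]
  refine card_nbij (fun y => if y.1 < y.2 then (⟨y.1, by omega⟩, ⟨y.2 + 2, by omega⟩)
    else (⟨y.1 + 1, by omega⟩, ⟨y.2, by omega⟩)) ?_ ?_ ?_
  · rintro ⟨i, j⟩ h
    simp only [coe_offDiag, coe_univ, Set.mem_offDiag, Set.mem_univ, ne_eq, true_and,
      Fin.ext_iff] at h
    simp only [coe_filter, mem_univ, true_and, Set.mem_ofPred_eq, Fin.lt_def]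
    simp only [FarPair]
    split_ifs <;> simp only <;> omega
  · rintro ⟨i, j⟩ h ⟨i', j'⟩ h' e
    simp only [coe_offDiag, coe_univ, Set.mem_offDiag, Set.mem_univ, ne_eq, true_and,
      Fin.ext_iff] at h h'
    simp only [Fin.lt_def] at e
    split_ifs at e <;> simp only [Prod.mk.injEq, Fin.ext_iff] at e ⊢ <;> omega
  · rintro ⟨⟨i, hi⟩, ⟨j, hj⟩⟩ h
    simp only [coe_filter, mem_univ, true_and, Set.mem_ofPred_eq] at h
    simp only [FarPair] at h
    rcases h with h | h
    · refine ⟨(⟨i - 1, by omega⟩, ⟨j, by omega⟩), ?_, ?_⟩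
      · simp; omega
      · simp only [Fin.lt_def]; rw [if_neg (by omega)]; simp; omega
    · refine ⟨(⟨i, by omega⟩, ⟨j - 2, by omega⟩), ?_, ?_⟩
      · simp; omega
      · simp only [Fin.lt_def]; rw [if_pos (by omega)]; simp; omega

open Finset in
/-- Ordered pairs of values at distance `d`. -/
theorem card_tuple_dist {n d : ℕ} (hd : 0 < d) :
    #{g : Fin 2 → Fin n | Function.Injective g ∧
      ((g 0 : ℤ) - (g 1 : ℤ)).natAbs = d} = 2 * (n - d) := by
  have : #(univ : Finset (Fin (n - d) × Bool)) = 2 * (n - d) := by simp [mul_comm]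
  rw [← this, eq_comm]
  refine card_nbij (fun y => if y.2 then ![⟨y.1, by omega⟩, ⟨y.1 + d, by omega⟩]
    else ![⟨y.1 + d, by omega⟩, ⟨y.1, by omega⟩]) ?_ ?_ ?_
  · rintro ⟨i, _ | _⟩ - <;>
    · simp only [coe_filter, mem_univ, true_and, Set.mem_ofPred_eq]
      refine ⟨?_, by simp⟩
      intro a b
      fin_cases a <;> fin_cases b <;> simp <;> omega
  · rintro ⟨i, _ | _⟩ - ⟨j, _ | _⟩ - h <;>
      have h0 := congrFun h 0 <;> have h1 := congrFun h 1 <;>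
      simp [Fin.ext_iff] at h0 h1 ⊢ <;> omega
  · intro g h
    simp only [coe_filter, mem_univ, true_and, Set.mem_ofPred_eq] at h
    obtain ⟨-, h⟩ := h
    by_cases h' : (g 0 : ℕ) < g 1
    · refine ⟨(⟨g 0, by omega⟩, true), by simp, ?_⟩
      ext a
      fin_cases a <;> simp; omega
    · refine ⟨(⟨g 1, by omega⟩, false), by simp, ?_⟩
      ext a
      fin_cases a <;> simp; omega

open Finset in
theorem card_tuple_far (n : ℕ) :
    #{g : Fin 5 → Fin n | Function.Injective g ∧ ((g 0 : ℤ) - (g 2 : ℤ)).natAbs = 1 ∧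
      ((g 3 : ℤ) - (g 4 : ℤ)).natAbs = 2 ∧ (g 3 : ℤ) + (g 4 : ℤ) = 2 * (g 1 : ℤ)} =
      4 * ((n - 3) * (n - 4)) := by
  have : #(({x : Fin (n - 2) × Fin (n - 1) | FarPair x} : Finset _) ×ˢ
      (univ : Finset (Bool × Bool))) = 4 * ((n - 3) * (n - 4)) := by
    rw [card_product, card_farPair, mul_comm]; rfl
  rw [← this, eq_comm]
  refine card_nbij (fun y =>
    ![⟨if y.2.1 then y.1.2 else y.1.2 + 1, by split_ifs <;> omega⟩, ⟨y.1.1 + 1, by omega⟩,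
      ⟨if y.2.1 then y.1.2 + 1 else y.1.2, by split_ifs <;> omega⟩,
      ⟨if y.2.2 then y.1.1 else y.1.1 + 2, by split_ifs <;> omega⟩,
      ⟨if y.2.2 then y.1.1 + 2 else y.1.1, by split_ifs <;> omega⟩]) ?_ ?_ ?_
  · rintro ⟨⟨⟨j, hj⟩, ⟨q, hq⟩⟩, ⟨e, f⟩⟩ h
    simp only [coe_product, coe_filter, coe_univ, Set.mem_prod, Set.mem_ofPred_eq, mem_univ,
      true_and, Set.mem_univ, and_true] at h ⊢
    simp only [FarPair] at h
    refine ⟨?_, ?_⟩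
    · intro a b
      fin_cases a <;> fin_cases b <;> cases e <;> cases f <;> simp <;> omega
    · cases e <;> cases f <;> simp <;> omega
  · rintro ⟨⟨⟨j, hj⟩, ⟨q, hq⟩⟩, ⟨e, f⟩⟩ - ⟨⟨⟨j', hj'⟩, ⟨q', hq'⟩⟩, ⟨e', f'⟩⟩ - h
    have h0 := congrFun h 0
    have h1 := congrFun h 1
    have h2 := congrFun h 2
    have h3 := congrFun h 3
    cases e <;> cases f <;> cases e' <;> cases f' <;> simp at h0 h1 h2 h3 ⊢ <;> omega
  · intro g h
    simp only [coe_filter, mem_univ, true_and, Set.mem_ofPred_eq] at h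
    obtain ⟨hg, h1, h2, h3⟩ := h
    have n03 := Fin.val_ne_of_ne (hg.ne (show (0 : Fin 5) ≠ 3 by decide))
    have n04 := Fin.val_ne_of_ne (hg.ne (show (0 : Fin 5) ≠ 4 by decide))
    have n01 := Fin.val_ne_of_ne (hg.ne (show (0 : Fin 5) ≠ 1 by decide))
    have n21 := Fin.val_ne_of_ne (hg.ne (show (2 : Fin 5) ≠ 1 by decide))
    have n23 := Fin.val_ne_of_ne (hg.ne (show (2 : Fin 5) ≠ 3 by decide))
    have n24 := Fin.val_ne_of_ne (hg.ne (show (2 : Fin 5) ≠ 4 by decide))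
    refine ⟨((⟨g 1 - 1, by omega⟩, ⟨min (g 0) (g 2), by omega⟩),
      (decide ((g 0 : ℕ) < g 2), decide ((g 3 : ℕ) < g 4))), ?_, ?_⟩
    · simp only [coe_product, coe_filter, coe_univ, Set.mem_prod, Set.mem_ofPred_eq, mem_univ,
        true_and, Set.mem_univ, and_true]
      simp only [FarPair]
      omega
    · ext a
      fin_cases a <;> simp <;> (try split_ifs) <;> omega

open Finset in
theorem card_tuple_touching (n : ℕ) :
    #{g : Fin 4 → Fin n | Function.Injective g ∧ ((g 0 : ℤ) - (g 2 : ℤ)).natAbs = 1 ∧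
      ((g 2 : ℤ) - (g 3 : ℤ)).natAbs = 2 ∧ (g 2 : ℤ) + (g 3 : ℤ) = 2 * (g 1 : ℤ)} =
      2 * (n - 3) := by
  have : #(univ : Finset (Fin (n - 3) × Bool)) = 2 * (n - 3) := by simp [mul_comm]
  rw [← this, eq_comm]
  refine card_nbij (fun y => if y.2 then
      ![⟨y.1 + 3, by omega⟩, ⟨y.1 + 1, by omega⟩, ⟨y.1 + 2, by omega⟩, ⟨y.1, by omega⟩]
    else ![⟨y.1, by omega⟩, ⟨y.1 + 2, by omega⟩, ⟨y.1 + 1, by omega⟩, ⟨y.1 + 3, by omega⟩])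
    ?_ ?_ ?_
  · rintro ⟨i, _ | _⟩ - <;>
    · simp only [coe_filter, mem_univ, true_and, Set.mem_ofPred_eq]
      refine ⟨?_, by simp; omega⟩
      intro a b
      fin_cases a <;> fin_cases b <;> simp
  · rintro ⟨i, _ | _⟩ - ⟨j, _ | _⟩ - h <;>
      have h0 := congrFun h 0 <;> have h1 := congrFun h 1 <;>
      simp [Fin.ext_iff] at h0 h1 ⊢ <;> omega
  · intro g h
    simp only [coe_filter, mem_univ, true_and, Set.mem_ofPred_eq] at h
    obtain ⟨hg, h1, h2, h3⟩ := h
    have n01 := Fin.val_ne_of_ne (hg.ne (show (0 : Fin 4) ≠ 1 by decide))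
    by_cases h' : (g 0 : ℕ) < g 1
    · refine ⟨(⟨g 0, by omega⟩, false), by simp, ?_⟩
      ext a
      fin_cases a <;> simp <;> omega
    · refine ⟨(⟨g 3, by omega⟩, true), by simp, ?_⟩
      ext a
      fin_cases a <;> simp <;> omega

/-- The entries of `σ` at positions `j` and `j+2` are consecutive values. -/
abbrev VCond {n : ℕ} (σ : Equiv.Perm (Fin n)) (j : Fin (n - 2)) : Prop :=
  ((σ ⟨j, by omega⟩ : ℤ) - (σ ⟨j + 2, by omega⟩ : ℤ)).natAbs = 1

/-- The entries of `σ` at positions `q` and `q+1` differ by two. -/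
abbrev HCond {n : ℕ} (σ : Equiv.Perm (Fin n)) (q : Fin (n - 1)) : Prop :=
  ((σ ⟨q, by omega⟩ : ℤ) - (σ ⟨q + 1, by omega⟩ : ℤ)).natAbs = 2

/-- The entry at position `j+1` is a vertical separator, and it is a horizontal separator
witnessed by the positions `q, q+1`. -/
abbrev BothCond {n : ℕ} (σ : Equiv.Perm (Fin n)) (x : Fin (n - 2) × Fin (n - 1)) : Prop :=
  VCond σ x.1 ∧ HCond σ x.2 ∧ (σ ⟨x.2, by omega⟩ : ℤ) + (σ ⟨x.2 + 1, by omega⟩ : ℤ) =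
    2 * (σ ⟨x.1 + 1, by omega⟩ : ℤ)

theorem isVSepVal_iff {n : ℕ} (σ : Equiv.Perm (Fin n)) (b : Fin n) :
    IsVSepVal σ b ↔ ∃ j : Fin (n - 2), σ ⟨j + 1, by omega⟩ = b ∧ VCond σ j := by
  constructor
  · rintro ⟨j, h, hj, hd⟩
    refine ⟨⟨j, by omega⟩, ?_, hd⟩
    rw [← Equiv.Perm.eq_inv_iff_eq]
    exact Fin.ext hj.symm
  · rintro ⟨j, rfl, hd⟩
    exact ⟨j, by omega, by simp, hd⟩

theorem isHSepVal_iff {n : ℕ} (σ : Equiv.Perm (Fin n)) (b : Fin n) :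
    IsHSepVal σ b ↔ ∃ q : Fin (n - 1), HCond σ q ∧
      (σ ⟨q, by omega⟩ : ℤ) + (σ ⟨q + 1, by omega⟩ : ℤ) = 2 * (b : ℤ) := by
  constructor
  · rintro ⟨j, h, hd⟩
    exact ⟨⟨j, by omega⟩, hd⟩
  · rintro ⟨q, hd⟩
    exact ⟨q, by omega, hd⟩

open Finset Classical in
theorem card_isVSepVal {n : ℕ} (σ : Equiv.Perm (Fin n)) :
    #{b | IsVSepVal σ b} = #{j | VCond σ j} := by
  symm
  refine card_nbij (fun j => σ ⟨j + 1, by omega⟩) ?_ ?_ ?_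
  · intro j hj
    simp only [coe_filter, mem_univ, true_and, Set.mem_ofPred_eq] at hj ⊢
    exact (isVSepVal_iff σ _).2 ⟨j, rfl, hj⟩
  · rintro j - j' - h
    simpa [Fin.ext_iff] using σ.injective h
  · intro b hb
    simp only [coe_filter, mem_univ, true_and, Set.mem_ofPred_eq] at hb
    obtain ⟨j, hj, hd⟩ := (isVSepVal_iff σ b).1 hb
    exact ⟨j, by simpa using hd, hj⟩

/-- The positions of an adjacent pair are determined by the two values, up to order. -/
theorem adjacent_unique {n : ℕ} (σ : Equiv.Perm (Fin n)) {q q' : Fin (n - 1)} (h : HCond σ q)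
    (h' : HCond σ q')
    (hs : (σ ⟨q, by omega⟩ : ℤ) + (σ ⟨q + 1, by omega⟩ : ℤ) =
      (σ ⟨q', by omega⟩ : ℤ) + (σ ⟨q' + 1, by omega⟩ : ℤ)) : q = q' := by
  have key : (σ ⟨q, by omega⟩ : ℕ) = σ ⟨q', by omega⟩ ∨
      ((σ ⟨q, by omega⟩ : ℕ) = σ ⟨q' + 1, by omega⟩ ∧
        (σ ⟨q + 1, by omega⟩ : ℕ) = σ ⟨q', by omega⟩) := by
    unfold HCond at h h'
    omega
  rcases key with h | ⟨h1, h2⟩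
  · simpa [Fin.ext_iff] using σ.injective (Fin.ext h)
  · have h1 := congrArg Fin.val (σ.injective (Fin.ext h1))
    have h2 := congrArg Fin.val (σ.injective (Fin.ext h2))
    simp only at h1 h2
    omega

open Finset Classical in
theorem card_isHSepVal {n : ℕ} (σ : Equiv.Perm (Fin n)) :
    #{b | IsHSepVal σ b} = #{q | HCond σ q} := by
  symm
  refine card_nbij (fun q => ⟨((σ ⟨q, by omega⟩ : ℕ) + σ ⟨q + 1, by omega⟩) / 2, by omega⟩)
    ?_ ?_ ?_
  · intro q hq
    simp only [coe_filter, mem_univ, true_and, Set.mem_ofPred_eq] at hq ⊢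
    refine (isHSepVal_iff σ _).2 ⟨q, hq, ?_⟩
    unfold HCond at hq
    simp only
    omega
  · intro q hq q' hq' h
    simp only [coe_filter, mem_univ, true_and, Set.mem_ofPred_eq] at hq hq'
    refine adjacent_unique σ hq hq' ?_
    unfold HCond at hq hq'
    simp only [Fin.ext_iff] at h
    omega
  · intro b hb
    simp only [coe_filter, mem_univ, true_and, Set.mem_ofPred_eq] at hb
    obtain ⟨q, hq, hs⟩ := (isHSepVal_iff σ b).1 hb
    refine ⟨q, by simpa using hq, Fin.ext ?_⟩
    simp only
    omega

open Finset Classical in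
theorem card_isVSepVal_and_isHSepVal {n : ℕ} (σ : Equiv.Perm (Fin n)) :
    #{b | IsVSepVal σ b ∧ IsHSepVal σ b} = #{x | BothCond σ x} := by
  symm
  refine card_nbij (fun x => σ ⟨x.1 + 1, by omega⟩) ?_ ?_ ?_
  · intro x hx
    simp only [coe_filter, mem_univ, true_and, Set.mem_ofPred_eq] at hx ⊢
    exact ⟨(isVSepVal_iff σ _).2 ⟨x.1, rfl, hx.1⟩, (isHSepVal_iff σ _).2 ⟨x.2, hx.2⟩⟩
  · rintro ⟨j, q⟩ hx ⟨j', q'⟩ hx' h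
    simp only [coe_filter, mem_univ, true_and, Set.mem_ofPred_eq] at hx hx'
    obtain rfl : j = j' := by simpa [Fin.ext_iff] using σ.injective h
    exact congrArg (Prod.mk j) (adjacent_unique σ hx.2.1 hx'.2.1 (hx.2.2.trans hx'.2.2.symm))
  · intro b hb
    simp only [coe_filter, mem_univ, true_and, Set.mem_ofPred_eq] at hb
    obtain ⟨j, rfl, hd⟩ := (isVSepVal_iff σ b).1 hb.1
    obtain ⟨q, hq⟩ := (isHSepVal_iff σ _).1 hb.2
    refine ⟨(j, q), ?_, rfl⟩
    simp only [coe_filter, mem_univ, true_and, Set.mem_ofPred_eq]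
    exact ⟨hd, hq⟩

open Finset in
theorem card_perm_vCond {n : ℕ} (j : Fin (n - 2)) :
    #{σ : Equiv.Perm (Fin n) | VCond σ j} = 2 * (n - 1) * (n - 2).factorial := by
  rw [← card_tuple_dist one_pos]
  refine card_perm_comp_prop ![⟨j, by omega⟩, ⟨j + 2, by omega⟩] ?_
    (fun g => ((g 0 : ℤ) - (g 1 : ℤ)).natAbs = 1)
  intro a b
  fin_cases a <;> fin_cases b <;> simp

open Finset in
theorem card_perm_hCond {n : ℕ} (q : Fin (n - 1)) :
    #{σ : Equiv.Perm (Fin n) | HCond σ q} = 2 * (n - 2) * (n - 2).factorial := by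
  rw [← card_tuple_dist two_pos]
  refine card_perm_comp_prop ![⟨q, by omega⟩, ⟨q + 1, by omega⟩] ?_
    (fun g => ((g 0 : ℤ) - (g 1 : ℤ)).natAbs = 2)
  intro a b
  fin_cases a <;> fin_cases b <;> simp

open Finset in
theorem card_perm_bothCond_of_farPair {n : ℕ} {x : Fin (n - 2) × Fin (n - 1)} (hx : FarPair x) :
    #{σ : Equiv.Perm (Fin n) | BothCond σ x} =
      4 * ((n - 3) * (n - 4)) * (n - 5).factorial := by
  rw [← card_tuple_far]
  refine card_perm_comp_prop ![⟨x.1, by omega⟩, ⟨x.1 + 1, by omega⟩, ⟨x.1 + 2, by omega⟩,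
    ⟨x.2, by omega⟩, ⟨x.2 + 1, by omega⟩] ?_
    (fun g => ((g 0 : ℤ) - (g 2 : ℤ)).natAbs = 1 ∧
      ((g 3 : ℤ) - (g 4 : ℤ)).natAbs = 2 ∧ (g 3 : ℤ) + (g 4 : ℤ) = 2 * (g 1 : ℤ))
  unfold FarPair at hx
  intro a b
  fin_cases a <;> fin_cases b <;> simp <;> omega

open Finset in
theorem card_perm_bothCond_of_touchingPair {n : ℕ} {x : Fin (n - 2) × Fin (n - 1)}
    (hx : TouchingPair x) :
    #{σ : Equiv.Perm (Fin n) | BothCond σ x} = 2 * (n - 3) * (n - 4).factorial := by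
  obtain ⟨⟨j, hj⟩, ⟨q, hq⟩⟩ := x
  simp only [TouchingPair] at hx
  rw [← card_tuple_touching]
  rcases hx with rfl | rfl
  · refine Eq.trans (congrArg card (filter_congr fun σ _ => ?_)) (card_perm_comp_prop
      ![⟨q + 1 + 2, by omega⟩, ⟨q + 1 + 1, by omega⟩, ⟨q + 1, by omega⟩, ⟨q, by omega⟩] ?_ _)
    · change (_ ∧ _ ∧ _) ↔ ((σ ⟨q + 1 + 2, by omega⟩ : ℤ) - (σ ⟨q + 1, by omega⟩ : ℤ)).natAbs = 1 ∧
        ((σ ⟨q + 1, by omega⟩ : ℤ) - (σ ⟨q, by omega⟩ : ℤ)).natAbs = 2 ∧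
        (σ ⟨q + 1, by omega⟩ : ℤ) + (σ ⟨q, by omega⟩ : ℤ) = 2 * (σ ⟨q + 1 + 1, by omega⟩ : ℤ)
      simp only [VCond, HCond]
      omega
    · intro a b
      fin_cases a <;> fin_cases b <;> simp <;> omega
  · refine card_perm_comp_prop ![⟨j, by omega⟩, ⟨j + 1, by omega⟩, ⟨j + 2, by omega⟩,
      ⟨j + 3, by omega⟩] ?_
      (fun g => ((g 0 : ℤ) - (g 2 : ℤ)).natAbs = 1 ∧
        ((g 2 : ℤ) - (g 3 : ℤ)).natAbs = 2 ∧ (g 2 : ℤ) + (g 3 : ℤ) = 2 * (g 1 : ℤ))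
    intro a b
    fin_cases a <;> fin_cases b <;> simp

theorem not_bothCond {n : ℕ} {x : Fin (n - 2) × Fin (n - 1)} (hf : ¬ FarPair x)
    (ht : ¬ TouchingPair x) (σ : Equiv.Perm (Fin n)) : ¬ BothCond σ x := by
  obtain ⟨⟨j, hj⟩, ⟨q, hq⟩⟩ := x
  simp only [FarPair, TouchingPair] at hf ht
  rintro ⟨-, h2, h3⟩
  obtain rfl | rfl : q = j ∨ q = j + 1 := by omega
  all_goals
    simp only [HCond] at h2 h3
    omega

open Finset in
theorem sum_card_bothCond (n : ℕ) :
    ∑ σ : Equiv.Perm (Fin n), #{x | BothCond σ x} =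
      (n - 3) * (n - 4) * (4 * ((n - 3) * (n - 4)) * (n - 5).factorial) +
      2 * (n - 3) * (2 * (n - 3) * (n - 4).factorial) := by
  refine (sum_card_bipartiteAbove_eq_sum_card_bipartiteBelow (s := univ) (t := univ)
    (fun σ x => BothCond σ x)).trans ?_
  have key : ∀ x : Fin (n - 2) × Fin (n - 1), #{σ : Equiv.Perm (Fin n) | BothCond σ x} =
      (if FarPair x then 4 * ((n - 3) * (n - 4)) * (n - 5).factorial else 0) +
      (if TouchingPair x then 2 * (n - 3) * (n - 4).factorial else 0) := by
    intro x
    by_cases hf : FarPair x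
    · have ht : ¬ TouchingPair x := by
        unfold FarPair at hf
        unfold TouchingPair
        omega
      rw [if_pos hf, if_neg ht, add_zero, card_perm_bothCond_of_farPair hf]
    · by_cases ht : TouchingPair x
      · rw [if_neg hf, if_pos ht, zero_add, card_perm_bothCond_of_touchingPair ht]
      · rw [if_neg hf, if_neg ht, add_zero, card_eq_zero, filter_eq_empty_iff]
        exact fun σ _ => not_bothCond hf ht σ
  simp only [bipartiteBelow, key, sum_add_distrib, ← sum_filter, sum_const, card_farPair,
    card_touchingPair, smul_eq_mul]

open Finset Classical in
theorem sum_card_separators (n : ℕ) :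
    ∑ σ : Equiv.Perm (Fin n), Nat.card {b : Fin n // IsVSepVal σ b ∨ IsHSepVal σ b} +
      ((n - 3) * (n - 4) * (4 * ((n - 3) * (n - 4)) * (n - 5).factorial) +
        2 * (n - 3) * (2 * (n - 3) * (n - 4).factorial)) =
      (n - 2) * (2 * (n - 1) * (n - 2).factorial) +
        (n - 1) * (2 * (n - 2) * (n - 2).factorial) := by
  have hV : ∑ σ : Equiv.Perm (Fin n), #{j | VCond σ j} =
      (n - 2) * (2 * (n - 1) * (n - 2).factorial) := by
    refine (sum_card_bipartiteAbove_eq_sum_card_bipartiteBelow (s := univ) (t := univ)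
      (fun σ j => VCond σ j)).trans ?_
    simp [bipartiteBelow, card_perm_vCond]
  have hH : ∑ σ : Equiv.Perm (Fin n), #{q | HCond σ q} =
      (n - 1) * (2 * (n - 2) * (n - 2).factorial) := by
    refine (sum_card_bipartiteAbove_eq_sum_card_bipartiteBelow (s := univ) (t := univ)
      (fun σ q => HCond σ q)).trans ?_
    simp [bipartiteBelow, card_perm_hCond]
  rw [← sum_card_bothCond, ← hV, ← hH, ← sum_add_distrib, ← sum_add_distrib]
  refine sum_congr rfl fun σ _ => ?_
  rw [Nat.card_eq_fintype_card, Fintype.card_subtype, ← card_isVSepVal, ← card_isHSepVal,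
    ← card_isVSepVal_and_isHSepVal, filter_or, filter_and, card_union_add_card_inter]

open Filter in
theorem tendsto_expected_separators :
    Tendsto (fun n : ℕ =>
        4 * ((n : ℝ) ^ 3 - 6 * (n : ℝ) ^ 2 + 14 * (n : ℝ) - 13)
          / ((n : ℝ) * ((n : ℝ) - 1) * ((n : ℝ) - 2)))
      atTop (nhds 4) := by
  have hi : Tendsto (fun n : ℕ => ((n : ℝ))⁻¹) atTop (nhds 0) :=
    tendsto_inv_atTop_nhds_zero_nat
  have hn := ((((hi.const_mul 6).const_sub 1).add ((hi.pow 2).const_mul 14)).sub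
    ((hi.pow 3).const_mul 13)).const_mul 4
  have hd := (hi.const_sub 1).mul ((hi.const_mul 2).const_sub 1)
  have h := hn.div hd (by norm_num)
  norm_num at h
  refine h.congr' ?_
  filter_upwards [eventually_ge_atTop 3] with n hn
  have h3 : (3 : ℝ) ≤ n := by exact_mod_cast hn
  have h0 : (n : ℝ) ≠ 0 := by linarith
  have h1 : (n : ℝ) - 1 ≠ 0 := by linarith
  have h2 : (n : ℝ) - 2 ≠ 0 := by linarith
  simp only [Pi.div_apply]
  field_simp

open Filter in
/-- the expected number of separators (vertical or horizontal,
counted once) of a uniformly random permutation of `S_n` is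
`4(n³ - 6n² + 14n - 13)/(n(n-1)(n-2))`, and this tends to `4` as `n → ∞`. -/
theorem stmt16 :
    (∀ n : ℕ, 5 ≤ n →
      (∑ σ : Equiv.Perm (Fin n),
          (Nat.card {b : Fin n // IsVSepVal σ b ∨ IsHSepVal σ b} : ℚ)) / (n.factorial : ℚ)
        = 4 * ((n : ℚ) ^ 3 - 6 * (n : ℚ) ^ 2 + 14 * (n : ℚ) - 13)
            / ((n : ℚ) * ((n : ℚ) - 1) * ((n : ℚ) - 2))) ∧
    Tendsto (fun n : ℕ =>
        4 * ((n : ℝ) ^ 3 - 6 * (n : ℝ) ^ 2 + 14 * (n : ℝ) - 13)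
          / ((n : ℝ) * ((n : ℝ) - 1) * ((n : ℝ) - 2)))
      atTop (nhds 4) := by
  refine ⟨fun n hn => ?_, tendsto_expected_separators⟩
  obtain ⟨m, rfl⟩ := Nat.exists_eq_add_of_le' hn
  have h := congrArg (Nat.cast (R := ℚ)) (sum_card_separators (m + 5))
  simp only [show m + 5 - 1 = m + 4 by omega, show m + 5 - 2 = m + 3 by omega,
    show m + 5 - 3 = m + 2 by omega, show m + 5 - 4 = m + 1 by omega,
    show m + 5 - 5 = m by omega, Nat.factorial_succ] at h
  push_cast at h
  rw [← eq_sub_iff_add_eq] at h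
  rw [h]
  simp only [Nat.factorial_succ]
  have hm : (m.factorial : ℚ) ≠ 0 := by exact_mod_cast m.factorial_ne_zero
  push_cast
  rw [show (m : ℚ) + 5 - 1 = m + 4 by ring, show (m : ℚ) + 5 - 2 = m + 3 by ring]
  field_simp
  ring
end
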